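/- Let F = {f_1,…,f_N} and G = {g_1,…,g_N} be post-critically finite IFSs of contracting similitudes on complete metric spaces (X,d_1) and (Y,d_2), with attractors K, K' and contraction ratios r_i, r'_i respectively. Assume both F and G satisfy the single intersection condition and the angle separation condition, and that F and G have the same topology automaton, rendered combinatorially as: for every n ≥ 1 and all words I, J ∈ {1,…,N}^n, f_I(K) ∩ f_J(K) = ∅ if and only if g_I(K') ∩ g_J(K') = ∅. If there exists s > 0 such that r'_i = (r_i)^s for every i ∈ ∂Σ_K, then (K,d_1) and (K',d_2) are quasisymmetrically equivalent: there exists a quasisymmetric homeomorphism h : K → K'. -/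

import Mathlib

open Set Metric
open scoped ENNReal

/-- `wordMap f [i₁,…,i_k] = f i₁ ∘ ⋯ ∘ f i_k`. -/
def wordMap {X : Type*} {ι : Type*} (f : ι → X → X) : List ι → X → X
  | [] => id
  | i :: I => f i ∘ wordMap f I

/-- The prefix word `x₁ ⋯ x_n` of an infinite word `x`. -/
def pre {ι : Type*} (x : ℕ → ι) (n : ℕ) : List ι := List.ofFn (fun j : Fin n => x j)

/-- `K` is the attractor of the IFS `f`: the (unique) nonempty compact set with
`K = ⋃ i, f i '' K`. -/
def IsAttractor {X : Type*} [MetricSpace X] {ι : Type*} (f : ι → X → X) (K : Set X) : Prop :=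
  K.Nonempty ∧ IsCompact K ∧ K = ⋃ i, f i '' K

/-- `g` is a bi-Lipschitz contraction. -/
def IsBiLipContraction {X : Type*} [MetricSpace X] (g : X → X) : Prop :=
  ∃ A B : ℝ, 0 < A ∧ B < 1 ∧ ∀ x y : X,
    A * dist x y ≤ dist (g x) (g y) ∧ dist (g x) (g y) ≤ B * dist x y

/-- `g` is a similitude of ratio `r`. -/
def IsSimilitude {X : Type*} [MetricSpace X] (g : X → X) (r : ℝ) : Prop :=
  ∀ x y : X, dist (g x) (g y) = r * dist x y

/-- The critical set `C_F = ⋃_{i ≠ j} f_i(K) ∩ f_j(K)`. -/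
def criticalSet {X : Type*} {ι : Type*} (f : ι → X → X) (K : Set X) : Set X :=
  ⋃ (i : ι) (j : ι) (_ : i ≠ j), (f i '' K) ∩ (f j '' K)

/-- The post-critical set `P_F = ⋃_{ω ∈ Σ^*} f_ω⁻¹(C_F) ∩ K`. -/
def postCriticalSet {X : Type*} {ι : Type*} (f : ι → X → X) (K : Set X) : Set X :=
  {p | p ∈ K ∧ ∃ I : List ι, I ≠ [] ∧ wordMap f I p ∈ criticalSet f K}

/-- `π` is the coding map of `(f, K)`: `{π x} = ⋂_k f_{x₁⋯x_k}(K)`. -/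
def IsCodingMap {X : Type*} {ι : Type*} (f : ι → X → X) (K : Set X)
    (π : (ℕ → ι) → X) : Prop :=
  ∀ x : ℕ → ι, (⋂ k : ℕ, wordMap f (pre x (k + 1)) '' K) = {π x}

/-- Single intersection condition: `f_i(K) ∩ f_j(K)` contains at most one point for `i ≠ j`. -/
def SIC {X : Type*} {ι : Type*} (f : ι → X → X) (K : Set X) : Prop :=
  ∀ i j : ι, i ≠ j → ((f i '' K) ∩ (f j '' K)).Subsingleton

/-- Angle separation condition with respect to a distance function `D`. -/
def ASCwrt {X : Type*} {ι : Type*} (f : ι → X → X) (K : Set X) (D : X → X → ℝ) : Prop :=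
  ∃ c : ℝ, 0 < c ∧ ∀ i j : ι, i ≠ j → ∀ z : X, (f i '' K) ∩ (f j '' K) = {z} →
    ∀ x ∈ f i '' K, ∀ y ∈ f j '' K, c * max (D x z) (D y z) ≤ D x y

/-- Angle separation condition. -/
def ASC {X : Type*} [MetricSpace X] {ι : Type*} (f : ι → X → X) (K : Set X) : Prop :=
  ASCwrt f K dist

/-- Lexicographic order on infinite words. -/
def lexLe {ι : Type*} [LinearOrder ι] (x y : ℕ → ι) : Prop :=
  x = y ∨ ∃ n : ℕ, (∀ k < n, x k = y k) ∧ x n < y n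

/-- `Σ_K`: the set of lowest codings, i.e. of words that are lexicographically least
among all words with the same image under the coding map `π`. -/
def lowestCodings {X : Type*} {ι : Type*} [LinearOrder ι] (π : (ℕ → ι) → X) :
    Set (ℕ → ι) :=
  {x | ∀ y : ℕ → ι, π y = π x → lexLe x y}

/-- `∂Σ_K`: the set of first letters of codings of post-critical points. -/
def bdryLetters {X : Type*} {ι : Type*} (f : ι → X → X) (K : Set X)
    (π : (ℕ → ι) → X) : Set ι :=
  {i | ∃ x : ℕ → ι, π x ∈ postCriticalSet f K ∧ x 0 = i}

/-- The contraction ratio `r_I = r_{i₁} ⋯ r_{i_k}` of a word. -/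
def rword {ι : Type*} (r : ι → ℝ) (I : List ι) : ℝ := (I.map r).prod

/-- The sequence `x` with its first `k` letters removed. -/
def seqShift {ι : Type*} (k : ℕ) (x : ℕ → ι) : ℕ → ι := fun n => x (n + k)

/-- The product of the ratios of the first `n` letters of `x`. -/
def prefixRatio {ι : Type*} (r : ι → ℝ) (x : ℕ → ι) (n : ℕ) : ℝ :=
  ∏ j ∈ Finset.range n, r (x j)

section Words

variable {X ι : Type*} {f : ι → X → X} {K : Set X} {π : (ℕ → ι) → X} {r : ι → ℝ}

lemma pre_succ (x : ℕ → ι) (n : ℕ) : pre x (n + 1) = x 0 :: pre (seqShift 1 x) n := by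
  simp [pre, seqShift, List.ofFn_succ]

lemma pre_length (x : ℕ → ι) (n : ℕ) : (pre x n).length = n := by
  simp [pre]

lemma wordMap_concat (f : ι → X → X) (I : List ι) (i : ι) (a : X) :
    wordMap f (I ++ [i]) a = wordMap f I (f i a) := by
  induction I with
  | nil => rfl
  | cons j I ih => simp [wordMap, ih]

lemma seqShift_seqShift (k l : ℕ) (x : ℕ → ι) :
    seqShift k (seqShift l x) = seqShift (l + k) x := by
  funext n
  simp only [seqShift]
  congr 1
  omega

lemma seqShift_zero (x : ℕ → ι) : seqShift 0 x = x := rfl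

lemma prefixRatio_succ (r : ι → ℝ) (x : ℕ → ι) (n : ℕ) :
    prefixRatio r x (n + 1) = prefixRatio r x n * r (x n) :=
  Finset.prod_range_succ _ _

lemma prefixRatio_add (r : ι → ℝ) (x : ℕ → ι) (m n : ℕ) :
    prefixRatio r x (m + n) = prefixRatio r x m * prefixRatio r (seqShift m x) n := by
  simp only [prefixRatio, seqShift, Finset.prod_range_add, add_comm]

lemma prefixRatio_pos (hr : ∀ i, 0 < r i) (x : ℕ → ι) (n : ℕ) : 0 < prefixRatio r x n :=
  Finset.prod_pos fun _ _ => hr _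

lemma prefixRatio_tendsto [Finite ι] (hr : ∀ i, 0 < r i ∧ r i < 1) (x : ℕ → ι) :
    Filter.Tendsto (prefixRatio r x) Filter.atTop (nhds 0) := by
  have : Nonempty ι := ⟨x 0⟩
  obtain ⟨i, hi⟩ := Finite.exists_max r
  refine squeeze_zero (fun n => (prefixRatio_pos (fun i => (hr i).1) x n).le) (fun n => ?_)
    (tendsto_pow_atTop_nhds_zero_of_lt_one (hr i).1.le (hr i).2)
  calc prefixRatio r x n ≤ ∏ _j ∈ Finset.range n, r i :=
        Finset.prod_le_prod (fun j _ => (hr _).1.le) fun j _ => hi _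
    _ = r i ^ n := by simp

lemma IsCodingMap.mem_image (hπ : IsCodingMap f K π) (x : ℕ → ι) (n : ℕ) :
    π x ∈ wordMap f (pre x (n + 1)) '' K := by
  have h : π x ∈ ⋂ k : ℕ, wordMap f (pre x (k + 1)) '' K := by rw [hπ x]; rfl
  exact mem_iInter.1 h n

lemma IsCodingMap.eq_of_mem (hπ : IsCodingMap f K π) {x : ℕ → ι} {a : X}
    (h : ∀ n, a ∈ wordMap f (pre x (n + 1)) '' K) : a = π x := by
  have h' : a ∈ ⋂ k : ℕ, wordMap f (pre x (k + 1)) '' K := mem_iInter.2 h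
  rw [hπ x] at h'
  exact h'

lemma mem_postCriticalSet_of_eq {i j : ι} (hij : i ≠ j) {p q : X} (hp : p ∈ K) (hq : q ∈ K)
    (h : f i p = f j q) : p ∈ postCriticalSet f K :=
  ⟨hp, [i], by simp, mem_iUnion.2 ⟨i, mem_iUnion.2 ⟨j, mem_iUnion.2
    ⟨hij, ⟨p, hp, rfl⟩, ⟨q, hq, h.symm⟩⟩⟩⟩⟩

variable [MetricSpace X]

lemma IsAttractor.image_subset (hK : IsAttractor f K) (i : ι) : f i '' K ⊆ K := by
  conv_rhs => rw [hK.2.2]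
  exact subset_iUnion (fun i => f i '' K) i

lemma IsAttractor.map_mem (hK : IsAttractor f K) {i : ι} {a : X} (ha : a ∈ K) : f i a ∈ K :=
  hK.image_subset i (mem_image_of_mem _ ha)

lemma IsAttractor.wordMap_mem (hK : IsAttractor f K) (I : List ι) {a : X} (ha : a ∈ K) :
    wordMap f I a ∈ K := by
  induction I with
  | nil => exact ha
  | cons i I ih => exact hK.map_mem ih

lemma IsCodingMap.mem (hπ : IsCodingMap f K π) (hK : IsAttractor f K) (x : ℕ → ι) :
    π x ∈ K := by
  obtain ⟨a, ha, h⟩ := hπ.mem_image x 0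
  exact h ▸ hK.wordMap_mem _ ha

lemma IsCodingMap.map_shift (hπ : IsCodingMap f K π) (hK : IsAttractor f K) (x : ℕ → ι) :
    f (x 0) (π (seqShift 1 x)) = π x := by
  refine hπ.eq_of_mem fun n => ?_
  rw [pre_succ]
  cases n with
  | zero => exact ⟨_, hπ.mem hK _, rfl⟩
  | succ n =>
    obtain ⟨a, ha, h⟩ := hπ.mem_image (seqShift 1 x) n
    exact ⟨a, ha, by simp [wordMap, h]⟩

lemma IsCodingMap.wordMap_shift (hπ : IsCodingMap f K π) (hK : IsAttractor f K) (x : ℕ → ι)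
    (n : ℕ) : wordMap f (pre x n) (π (seqShift n x)) = π x := by
  induction n generalizing x with
  | zero => rfl
  | succ n ih =>
    have h := ih (seqShift 1 x)
    rw [seqShift_seqShift, add_comm] at h
    rw [pre_succ, wordMap, Function.comp_apply, h, hπ.map_shift hK]

lemma IsCodingMap.exists_code (hπ : IsCodingMap f K π) (hK : IsAttractor f K) {a : X}
    (ha : a ∈ K) : ∃ x, π x = a := by
  have hex : ∀ b : K, ∃ q : ι × K, f q.1 q.2 = b := by
    rintro ⟨b, hb⟩
    rw [hK.2.2] at hb
    obtain ⟨i, c, hc, h⟩ := mem_iUnion.1 hb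
    exact ⟨(i, ⟨c, hc⟩), h⟩
  choose q hq using hex
  let b : K → ℕ → K := fun a n => (fun c => (q c).2)^[n] a
  let x : K → ℕ → ι := fun a n => (q (b a n)).1
  have hx : ∀ (n : ℕ) (a : K), wordMap f (pre (x a) n) (b a n) = a := by
    intro n
    induction n with
    | zero => intro a; rfl
    | succ n ih =>
      intro a
      have h := ih (q a).2
      rw [pre_succ]
      exact (congrArg (f (q a).1) h).trans (hq a)
  exact ⟨x ⟨a, ha⟩, (hπ.eq_of_mem fun n => ⟨b ⟨a, ha⟩ (n + 1), Subtype.coe_prop _, hx _ _⟩).symm⟩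

lemma IsCodingMap.map_cons (hπ : IsCodingMap f K π) (hK : IsAttractor f K) (i : ι) (x : ℕ → ι) :
    π (fun n => Nat.casesOn n i x) = f i (π x) :=
  (hπ.map_shift hK _).symm

/-- Points of `f_i(K)` have a coding that starts with `i`. -/
lemma IsCodingMap.exists_code_of_mem (hπ : IsCodingMap f K π) (hK : IsAttractor f K) {i : ι}
    {a : X} (ha : a ∈ f i '' K) : ∃ x, x 0 = i ∧ π x = a := by
  obtain ⟨b, hb, rfl⟩ := ha
  obtain ⟨x, rfl⟩ := hπ.exists_code hK hb
  exact ⟨fun n => Nat.casesOn n i x, rfl, hπ.map_cons hK i x⟩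

lemma IsCodingMap.mem_image_head (hπ : IsCodingMap f K π) (hK : IsAttractor f K) (x : ℕ → ι) :
    π x ∈ f (x 0) '' K :=
  ⟨_, hπ.mem hK _, hπ.map_shift hK x⟩

lemma IsCodingMap.dist_eq (hπ : IsCodingMap f K π) (hK : IsAttractor f K)
    (hf : ∀ i, IsSimilitude (f i) (r i)) {x y : ℕ → ι} {n : ℕ} (h : ∀ j < n, x j = y j) :
    dist (π x) (π y) = prefixRatio r x n * dist (π (seqShift n x)) (π (seqShift n y)) := by
  induction n with
  | zero => simp [prefixRatio, seqShift_zero]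
  | succ n ih =>
    rw [ih fun j hj => h j (by omega), ← hπ.map_shift hK (seqShift n x),
      ← hπ.map_shift hK (seqShift n y), seqShift_seqShift, seqShift_seqShift, prefixRatio_succ]
    have h0 : seqShift n y 0 = seqShift n x 0 := by simp [seqShift, h n (by omega)]
    rw [h0, hf, mul_assoc]
    simp [seqShift]

lemma IsCodingMap.map_shift_mem_postCriticalSet (hπ : IsCodingMap f K π) (hK : IsAttractor f K)
    {x : ℕ → ι} (hx : π x ∈ postCriticalSet f K) (n : ℕ) :
    π (seqShift n x) ∈ postCriticalSet f K := by
  induction n with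
  | zero => exact hx
  | succ n ih =>
    obtain ⟨-, I, hI, h⟩ := ih
    refine ⟨hπ.mem hK _, I ++ [seqShift n x 0], by simp, ?_⟩
    rw [wordMap_concat, ← seqShift_seqShift, hπ.map_shift hK]
    exact h

lemma IsCodingMap.mem_bdryLetters (hπ : IsCodingMap f K π) (hK : IsAttractor f K)
    {x : ℕ → ι} (hx : π x ∈ postCriticalSet f K) (n : ℕ) : x n ∈ bdryLetters f K π :=
  ⟨_, hπ.map_shift_mem_postCriticalSet hK hx n, by simp [seqShift]⟩

lemma IsCodingMap.finite_postCriticalSet (hπ : IsCodingMap f K π) (hK : IsAttractor f K)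
    (h : (π ⁻¹' postCriticalSet f K).Finite) : (postCriticalSet f K).Finite := by
  refine (h.image π).subset fun p hp => ?_
  obtain ⟨x, rfl⟩ := hπ.exists_code hK hp.1
  exact ⟨x, hp, rfl⟩

/-- If a coding of a point `p ≠ π u` agrees with `u` for as long as possible, then after the
common prefix the two codings are separated by a first-level cell. -/
lemma IsCodingMap.exists_maximal_code (hπ : IsCodingMap f K π) (hK : IsAttractor f K)
    {u : ℕ → ι} {p : X} (hp : p ∈ K) (hne : π u ≠ p) :
    ∃ (m : ℕ) (w : ℕ → ι), π w = p ∧ (∀ j < m, u j = w j) ∧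
      π (seqShift m w) ∉ f (u m) '' K := by
  classical
  by_contra hcon
  have key : ∀ m, ∃ w, π w = p ∧ ∀ j < m, u j = w j := by
    intro m
    induction m with
    | zero =>
      obtain ⟨w, hw⟩ := hπ.exists_code hK hp
      exact ⟨w, hw, by simp⟩
    | succ m ih =>
      obtain ⟨w, hw, hj⟩ := ih
      have hmem : π (seqShift m w) ∈ f (u m) '' K := by
        by_contra h
        exact hcon ⟨m, w, hw, hj, h⟩
      obtain ⟨v, hv0, hv⟩ := hπ.exists_code_of_mem hK hmem
      refine ⟨fun n => if n < m then u n else v (n - m), ?_, ?_⟩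
      · rw [← hw, ← hπ.wordMap_shift hK w m, ← hv,
          ← hπ.wordMap_shift hK (fun n => if n < m then u n else v (n - m)) m]
        have h1 : seqShift m (fun n => if n < m then u n else v (n - m)) = v := by
          funext n
          simp [seqShift]
        have h2 : pre (fun n => if n < m then u n else v (n - m)) m = pre w m := by
          simp only [pre]
          congr 1
          funext j
          simp [hj j j.2]
        rw [h1, h2]
      · intro j hj'
        rcases Nat.lt_succ_iff_lt_or_eq.1 hj' with h | rfl
        · simp [h]
        · simp [hv0]
  refine hne (hπ.eq_of_mem fun n => ?_).symm
  obtain ⟨w, hw, hj⟩ := key (n + 1)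
  have hpre : pre u (n + 1) = pre w (n + 1) := by
    simp only [pre]
    congr 1
    funext j
    exact hj j j.2
  rw [hpre, ← hw]
  exact hπ.mem_image w n

end Words

section Scales

variable {ι : Type*} {r r' : ι → ℝ} {x : ℕ → ι} {s α β C : ℝ}

lemma prefixRatio_rpow (hr : ∀ i, 0 < r i) (x : ℕ → ι) (s : ℝ) (n : ℕ) :
    prefixRatio (fun i => r i ^ s) x n = prefixRatio r x n ^ s :=
  Real.finsetProd_rpow _ _ (fun _ _ => (hr _).le) s

lemma prefixRatio_eq_rpow (hr : ∀ i, 0 < r i) {n : ℕ}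
    (h : ∀ j < n, r' (x j) = r (x j) ^ s) :
    prefixRatio r' x n = prefixRatio r x n ^ s := by
  rw [← prefixRatio_rpow hr]
  exact Finset.prod_congr rfl fun j hj => h j (Finset.mem_range.1 hj)

lemma prefixRatio_mono (hr : ∀ i, 0 < r i) (h : ∀ i, r i ≤ r' i) (x : ℕ → ι) (n : ℕ) :
    prefixRatio r x n ≤ prefixRatio r' x n :=
  Finset.prod_le_prod (fun _ _ => (hr _).le) fun _ _ => h _

/-- The size at which a distance `d`, measured from the cell of level `k` around the point coded
by `x`, is expected to appear for the ratios `r'`. -/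
noncomputable def transferredDist (r r' : ι → ℝ) (s : ℝ) (x : ℕ → ι) (k : ℕ) (d : ℝ) : ℝ :=
  prefixRatio r' x k * (d / prefixRatio r x k) ^ s

lemma transferredDist_pos (hr : ∀ i, 0 < r i) (hr' : ∀ i, 0 < r' i) (x : ℕ → ι) (k : ℕ) {d : ℝ}
    (hd : 0 < d) : 0 < transferredDist r r' s x k d :=
  mul_pos (prefixRatio_pos hr' x k) (Real.rpow_pos_of_pos (div_pos hd (prefixRatio_pos hr x k)) s)

lemma transferredDist_eq (hr : ∀ i, 0 < r i) {k n : ℕ} (hkn : k ≤ n)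
    (h : ∀ l, k ≤ l → l < n → r' (x l) = r (x l) ^ s) {d : ℝ} (hd : 0 ≤ d) :
    transferredDist r r' s x n d = transferredDist r r' s x k d := by
  obtain ⟨m, rfl⟩ := Nat.exists_eq_add_of_le hkn
  have h1 : prefixRatio r' (seqShift k x) m = prefixRatio r (seqShift k x) m ^ s :=
    prefixRatio_eq_rpow hr fun j hj => h (j + k) (by omega) (by omega)
  have hp := prefixRatio_pos hr x k
  have hq := prefixRatio_pos hr (seqShift k x) m
  rw [transferredDist, transferredDist, prefixRatio_add, prefixRatio_add, h1, mul_assoc,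
    ← Real.mul_rpow hq.le (by positivity)]
  congr 2
  field_simp

/-- `d` and `d'` are corresponding distances, from the points coded by `x`, whose scale is reached
inside a block of letters on which `r' = r ^ s`. -/
def HasScale (r r' : ι → ℝ) (s C : ℝ) (x : ℕ → ι) (d d' : ℝ) : Prop :=
  ∃ k n : ℕ, k ≤ n ∧ (∀ l, k ≤ l → l < n → r' (x l) = r (x l) ^ s) ∧
    prefixRatio r x n ≤ C * d ∧ d ≤ C * prefixRatio r x k ∧
    d' ≤ C * transferredDist r r' s x k d ∧ transferredDist r r' s x k d ≤ C * d'

lemma rpow_le_of_exponent_le {a : ℝ} (hC : 1 ≤ C) (ha : 0 < a) (hCa : 1 ≤ C * a) (hs : 0 < s)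
    (hsβ : s ≤ β) : a ^ s ≤ C ^ β * a ^ β := by
  have hC0 : 0 < C := by linarith
  calc a ^ s ≤ C ^ s * a ^ s := le_mul_of_one_le_left (by positivity) (Real.one_le_rpow hC hs.le)
    _ = (C * a) ^ s := (Real.mul_rpow hC0.le ha.le).symm
    _ ≤ (C * a) ^ β := Real.rpow_le_rpow_of_exponent_le hCa hsβ
    _ = C ^ β * a ^ β := Real.mul_rpow hC0.le ha.le

lemma rpow_le_of_le_exponent {a : ℝ} (hC : 1 ≤ C) (ha : 0 < a) (haC : a ≤ C) (hα : 0 < α)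
    (hαs : α ≤ s) : a ^ s ≤ C ^ s * a ^ α := by
  have hC0 : 0 < C := by linarith
  calc a ^ s = C ^ s * (a / C) ^ s := by
        rw [← Real.mul_rpow hC0.le (by positivity)]; congr 1; field_simp
    _ ≤ C ^ s * (a / C) ^ α := by
        gcongr ?_ * ?_
        exact Real.rpow_le_rpow_of_exponent_ge (by positivity) ((div_le_one hC0).2 haC) hαs
    _ ≤ C ^ s * a ^ α := by
        gcongr
        exact div_le_self ha.le hC

lemma rpow_le_add_rpow {a : ℝ} (ha : 0 < a) (hαs : α ≤ s) (hsβ : s ≤ β) :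
    a ^ s ≤ a ^ α + a ^ β := by
  have hα := Real.rpow_pos_of_pos ha α
  have hβ := Real.rpow_pos_of_pos ha β
  rcases le_total a 1 with h | h
  · linarith [Real.rpow_le_rpow_of_exponent_ge ha h hαs]
  · linarith [Real.rpow_le_rpow_of_exponent_le h hsβ]

lemma transferredDist_le (hr : ∀ i, 0 < r i) (hr' : ∀ i, 0 < r' i) {k : ℕ} {d₁ d₂ : ℝ}
    (hd₁ : 0 < d₁) (hd₂ : 0 < d₂) (hC : 1 ≤ C) (hαs : α ≤ s) (hsβ : s ≤ β) :
    transferredDist r r' s x k d₁ ≤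
      C * ((d₁ / d₂) ^ α + (d₁ / d₂) ^ β) * transferredDist r r' s x k d₂ := by
  have hp := prefixRatio_pos hr x k
  have h : transferredDist r r' s x k d₁ = (d₁ / d₂) ^ s * transferredDist r r' s x k d₂ := by
    rw [transferredDist, transferredDist, mul_left_comm, ← Real.mul_rpow (by positivity)
      (by positivity)]
    congr 2
    field_simp
  rw [h]
  have h1 := rpow_le_add_rpow (div_pos hd₁ hd₂) hαs hsβ
  have h2 : 0 < (d₁ / d₂) ^ s := by positivity
  refine mul_le_mul_of_nonneg_right ?_ (transferredDist_pos hr hr' x k hd₂).le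
  nlinarith

/-- The power-type distortion estimate at the level of scales. -/
lemma HasScale.le (hr : ∀ i, 0 < r i) (hr' : ∀ i, 0 < r' i) (hα : 0 < α) (hαs : α ≤ s)
    (hsβ : s ≤ β) (hrα : ∀ i, r' i ≤ r i ^ α) (hrβ : ∀ i, r i ^ β ≤ r' i) (hC : 1 ≤ C)
    {d₁ d₁' d₂ d₂' : ℝ} (hd₁ : 0 < d₁) (hd₂ : 0 < d₂)
    (h₁ : HasScale r r' s C x d₁ d₁') (h₂ : HasScale r r' s C x d₂ d₂') :
    d₁' ≤ C ^ 2 * (C ^ β) ^ 2 * ((d₁ / d₂) ^ α + (d₁ / d₂) ^ β) * d₂' := by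
  obtain ⟨k₁, n₁, hkn₁, he₁, hn₁, hk₁, hd₁', -⟩ := h₁
  obtain ⟨k₂, n₂, hkn₂, he₂, hn₂, hk₂, -, hd₂'⟩ := h₂
  have hC0 : 0 < C := by linarith
  have hs : 0 < s := by linarith
  have hCβ : 1 ≤ C ^ β := Real.one_le_rpow hC (by linarith)
  have hCs : C ^ s ≤ C ^ β := Real.rpow_le_rpow_of_exponent_le hC hsβ
  have hCs0 : 0 < C ^ s := by positivity
  have hCβ2 : 1 ≤ (C ^ β) ^ 2 := one_le_pow₀ hCβ
  have hα0 : 0 < (d₁ / d₂) ^ α := by positivity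
  have hβ0 : 0 < (d₁ / d₂) ^ β := by positivity
  have hT₂ := transferredDist_pos (s := s) hr hr' x k₂ hd₂
  have key : transferredDist r r' s x k₁ d₁ ≤
      (C ^ β) ^ 2 * ((d₁ / d₂) ^ α + (d₁ / d₂) ^ β) * transferredDist r r' s x k₂ d₂ := by
    rcases le_total k₁ k₂ with hk | hk
    · rcases le_or_gt k₂ n₁ with hkn | hkn
      · rw [transferredDist_eq hr hk (fun l h1 h2 => he₁ l h1 (by omega)) hd₂.le]
        exact transferredDist_le hr hr' hd₁ hd₂ hCβ2 hαs hsβ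
      · rw [← transferredDist_eq hr hkn₁ he₁ hd₁.le]
        obtain ⟨m, rfl⟩ := Nat.exists_eq_add_of_le hkn.le
        set y := seqShift n₁ x
        have hp := prefixRatio_pos hr x n₁
        have hp' := prefixRatio_pos hr' x n₁
        have hq := prefixRatio_pos hr y m
        have hq' := prefixRatio_pos hr' y m
        have hqq : prefixRatio r y m ^ β ≤ prefixRatio r' y m := by
          rw [← prefixRatio_rpow hr]
          exact prefixRatio_mono (fun i => Real.rpow_pos_of_pos (hr i) _) hrβ y m
        have hA := rpow_le_of_exponent_le (a := d₁ / prefixRatio r x n₁) hC (by positivity)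
          (by rw [← mul_div_assoc, le_div_iff₀ hp]; linarith) hs hsβ
        have hE := rpow_le_of_exponent_le (a := prefixRatio r x n₁ * prefixRatio r y m / d₂) hC
          (by positivity)
          (by rw [← mul_div_assoc, le_div_iff₀ hd₂, ← prefixRatio_add]; linarith) hs hsβ
        rw [transferredDist, transferredDist, prefixRatio_add, prefixRatio_add]
        set P := prefixRatio r x n₁
        set P' := prefixRatio r' x n₁
        set Q := prefixRatio r y m
        set Q' := prefixRatio r' y m
        have hinv : (P * Q / d₂) ^ s * (d₂ / (P * Q)) ^ s = 1 := by
          rw [← Real.mul_rpow (by positivity) (by positivity)]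
          have : P * Q / d₂ * (d₂ / (P * Q)) = 1 := by field_simp
          rw [this, Real.one_rpow]
        have hsplit : (d₁ / P) ^ β * (P * Q / d₂) ^ β = (d₁ / d₂) ^ β * Q ^ β := by
          rw [← Real.mul_rpow (by positivity) (by positivity),
            ← Real.mul_rpow (by positivity) (by positivity)]
          congr 1
          field_simp
        calc P' * (d₁ / P) ^ s
            = P' * ((d₁ / P) ^ s * (P * Q / d₂) ^ s) * (d₂ / (P * Q)) ^ s := by
              linear_combination (-(P' * (d₁ / P) ^ s)) * hinv
          _ ≤ P' * ((C ^ β * (d₁ / P) ^ β) * (C ^ β * (P * Q / d₂) ^ β)) *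
                (d₂ / (P * Q)) ^ s := by gcongr
          _ = P' * ((C ^ β) ^ 2 * (d₁ / d₂) ^ β * Q ^ β) * (d₂ / (P * Q)) ^ s := by
              linear_combination (P' * (C ^ β) ^ 2 * (d₂ / (P * Q)) ^ s) * hsplit
          _ ≤ P' * ((C ^ β) ^ 2 * ((d₁ / d₂) ^ α + (d₁ / d₂) ^ β) * Q') *
                (d₂ / (P * Q)) ^ s := by
              gcongr
              linarith
          _ = _ := by ring
    · rcases le_or_gt k₁ n₂ with hkn | hkn
      · rw [transferredDist_eq hr hk (fun l h1 h2 => he₂ l h1 (by omega)) hd₁.le]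
        exact transferredDist_le hr hr' hd₁ hd₂ hCβ2 hαs hsβ
      · rw [← transferredDist_eq hr hkn₂ he₂ hd₂.le]
        obtain ⟨m, rfl⟩ := Nat.exists_eq_add_of_le hkn.le
        set y := seqShift n₂ x
        have hp := prefixRatio_pos hr x n₂
        have hp' := prefixRatio_pos hr' x n₂
        have hq := prefixRatio_pos hr y m
        have hq' := prefixRatio_pos hr' y m
        have hqq : prefixRatio r' y m ≤ prefixRatio r y m ^ α := by
          rw [← prefixRatio_rpow hr]
          exact prefixRatio_mono hr' hrα y m
        rw [prefixRatio_add] at hk₁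
        have hA := rpow_le_of_le_exponent (a := d₁ / (prefixRatio r x n₂ * prefixRatio r y m)) hC
          (by positivity) (by rwa [div_le_iff₀ (by positivity)]) hα hαs
        have hE := rpow_le_of_le_exponent (a := prefixRatio r x n₂ / d₂) hC
          (by positivity) (by rwa [div_le_iff₀ hd₂]) hα hαs
        rw [transferredDist, transferredDist, prefixRatio_add, prefixRatio_add]
        set P := prefixRatio r x n₂
        set P' := prefixRatio r' x n₂
        set Q := prefixRatio r y m
        set Q' := prefixRatio r' y m
        have hinv : (P / d₂) ^ s * (d₂ / P) ^ s = 1 := by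
          rw [← Real.mul_rpow (by positivity) (by positivity)]
          have : P / d₂ * (d₂ / P) = 1 := by field_simp
          rw [this, Real.one_rpow]
        have hsplit : Q ^ α * ((d₁ / (P * Q)) ^ α * (P / d₂) ^ α) = (d₁ / d₂) ^ α := by
          rw [← Real.mul_rpow (by positivity) (by positivity),
            ← Real.mul_rpow (by positivity) (by positivity)]
          congr 1
          field_simp
        calc P' * Q' * (d₁ / (P * Q)) ^ s
            = P' * Q' * ((d₁ / (P * Q)) ^ s * (P / d₂) ^ s) * (d₂ / P) ^ s := by
              linear_combination (-(P' * Q' * (d₁ / (P * Q)) ^ s)) * hinv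
          _ ≤ P' * Q ^ α * ((C ^ s * (d₁ / (P * Q)) ^ α) * (C ^ s * (P / d₂) ^ α)) *
                (d₂ / P) ^ s := by gcongr
          _ = P' * ((C ^ s) ^ 2 * (d₁ / d₂) ^ α) * (d₂ / P) ^ s := by
              linear_combination (P' * (C ^ s) ^ 2 * (d₂ / P) ^ s) * hsplit
          _ ≤ P' * ((C ^ β) ^ 2 * ((d₁ / d₂) ^ α + (d₁ / d₂) ^ β)) * (d₂ / P) ^ s := by
              gcongr
              linarith
          _ = _ := by ring
  calc d₁' ≤ C * transferredDist r r' s x k₁ d₁ := hd₁'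
    _ ≤ C * ((C ^ β) ^ 2 * ((d₁ / d₂) ^ α + (d₁ / d₂) ^ β) *
          transferredDist r r' s x k₂ d₂) := by gcongr
    _ ≤ C * ((C ^ β) ^ 2 * ((d₁ / d₂) ^ α + (d₁ / d₂) ^ β) * (C * d₂')) := by gcongr
    _ = _ := by ring

lemma exists_rpow_bounds [Finite ι] (hr : ∀ i, 0 < r i ∧ r i < 1) (hr' : ∀ i, 0 < r' i ∧ r' i < 1)
    (hs : 0 < s) :
    ∃ α β : ℝ, 0 < α ∧ α ≤ s ∧ s ≤ β ∧ (∀ i, r' i ≤ r i ^ α) ∧ ∀ i, r i ^ β ≤ r' i := by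
  have h1 : ∀ᶠ α : ℝ in nhdsWithin 0 (Ioi 0), ∀ i, r' i ≤ r i ^ α := by
    rw [Filter.eventually_all]
    intro i
    have ht : Filter.Tendsto (fun α : ℝ => r i ^ α) (nhdsWithin 0 (Ioi 0)) (nhds 1) := by
      have := (Real.continuous_const_rpow (hr i).1.ne').tendsto 0
      rw [Real.rpow_zero] at this
      exact this.mono_left nhdsWithin_le_nhds
    exact (ht.eventually (lt_mem_nhds (hr' i).2)).mono fun _ h => le_of_lt h
  have h2 : ∀ᶠ β : ℝ in Filter.atTop, ∀ i, r i ^ β ≤ r' i := by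
    rw [Filter.eventually_all]
    intro i
    have ht := tendsto_rpow_atTop_of_base_lt_one (r i) (by linarith [(hr i).1]) (hr i).2
    exact (ht.eventually (gt_mem_nhds (hr' i).1)).mono fun _ h => le_of_lt h
  obtain ⟨α, h, hα⟩ := (h1.and (Ioc_mem_nhdsGT hs)).exists
  obtain ⟨β, h', hβ⟩ := (h2.and (Filter.eventually_ge_atTop s)).exists
  exact ⟨α, β, hα.1, hα.2, hβ, h, h'⟩

end Scales

lemma exists_pos_le_of_finite {κ : Type*} [Finite κ] {r : κ → ℝ} (hr : ∀ i, 0 < r i) :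
    ∃ ρ > 0, ∀ i, ρ ≤ r i := by
  cases isEmpty_or_nonempty κ with
  | inl _ => exact ⟨1, one_pos, fun i => isEmptyElim i⟩
  | inr _ =>
    obtain ⟨i, hi⟩ := Finite.exists_min r
    exact ⟨r i, hr i, hi⟩

/-- Finitely many pairs of disjoint compact sets are uniformly separated. -/
lemma exists_uniform_separation {X κ : Type*} [MetricSpace X] [Finite κ] {A B : κ → Set X}
    (hA : ∀ i, IsCompact (A i)) (hB : ∀ i, IsCompact (B i)) :
    ∃ δ > 0, ∀ i, Disjoint (A i) (B i) → ∀ a ∈ A i, ∀ b ∈ B i, δ ≤ dist a b := by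
  have h : ∀ i, ∃ δ > 0, Disjoint (A i) (B i) → ∀ a ∈ A i, ∀ b ∈ B i, δ ≤ dist a b := by
    intro i
    rcases (A i ×ˢ B i).eq_empty_or_nonempty with he | hne
    · refine ⟨1, one_pos, fun _ a ha b hb => ?_⟩
      exact absurd (mk_mem_prod ha hb) (by simp [he])
    · obtain ⟨q, hq, hmin⟩ := ((hA i).prod (hB i)).exists_isMinOn hne continuous_dist.continuousOn
      by_cases hd : Disjoint (A i) (B i)
      · exact ⟨dist q.1 q.2, dist_pos.2 (hd.ne_of_mem hq.1 hq.2),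
          fun _ a ha b hb => hmin (mk_mem_prod ha hb)⟩
      · exact ⟨1, one_pos, fun h => absurd h hd⟩
  choose δ hδ hsep using h
  obtain ⟨ρ, hρ, hle⟩ := exists_pos_le_of_finite hδ
  exact ⟨ρ, hρ, fun i hi a ha b hb => (hle i).trans (hsep i hi a ha b hb)⟩

section Conjugacy

variable {X Y ι : Type*} [MetricSpace Y] {f : ι → X → X} {g : ι → Y → Y}
  {K : Set X} {K' : Set Y} {πF : (ℕ → ι) → X} {πG : (ℕ → ι) → Y} {r r' : ι → ℝ}

lemma IsSimilitude.continuous {a : Y → Y} {ρ : ℝ} (h : IsSimilitude a ρ) : Continuous a := by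
  refine (LipschitzWith.of_dist_le_mul (K := ρ.toNNReal) fun x y => ?_).continuous
  rw [h]
  exact mul_le_mul_of_nonneg_right (Real.le_coe_toNNReal ρ) dist_nonneg

lemma IsAttractor.exists_dist_le (hK' : IsAttractor g K') :
    ∃ D > 0, ∀ a ∈ K', ∀ b ∈ K', dist a b ≤ D := by
  refine ⟨diam K' + 1, by positivity, fun a ha b hb => ?_⟩
  linarith [dist_le_diam_of_mem hK'.2.1.isBounded ha hb]

lemma IsCodingMap.eq_of_forall_inter_nonempty (hπG : IsCodingMap g K' πG)
    (hK' : IsAttractor g K') (hg : ∀ i, IsSimilitude (g i) (r' i))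
    {x y : ℕ → ι}
    (h : ∀ n, (wordMap g (pre x (n + 1)) '' K' ∩ wordMap g (pre y (n + 1)) '' K').Nonempty) :
    πG x = πG y := by
  have hcont : ∀ I : List ι, Continuous (wordMap g I) := by
    intro I
    induction I with
    | nil => exact continuous_id
    | cons i I ih => exact (hg i).continuous.comp ih
  have hanti : ∀ (z : ℕ → ι) (n : ℕ),
      wordMap g (pre z (n + 1)) '' K' ⊆ wordMap g (pre z n) '' K' := by
    intro z n
    rintro _ ⟨a, ha, rfl⟩
    have hz : pre z (n + 1) = pre z n ++ [z n] := by
      rw [pre, pre, List.ofFn_succ_last]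
      rfl
    rw [hz, wordMap_concat]
    exact ⟨_, hK'.map_mem ha, rfl⟩
  have hc : ∀ (z : ℕ → ι) (n : ℕ), IsCompact (wordMap g (pre z (n + 1)) '' K') :=
    fun z n => hK'.2.1.image (hcont _)
  obtain ⟨a, ha⟩ := IsCompact.nonempty_iInter_of_sequence_nonempty_isCompact_isClosed
    (fun n => wordMap g (pre x (n + 1)) '' K' ∩ wordMap g (pre y (n + 1)) '' K')
    (fun n => inter_subset_inter (hanti x (n + 1)) (hanti y (n + 1))) h
    ((hc x 0).inter (hc y 0)) (fun n => ((hc x n).inter (hc y n)).isClosed)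
  rw [mem_iInter] at ha
  exact (hπG.eq_of_mem fun n => (ha n).1).symm.trans (hπG.eq_of_mem fun n => (ha n).2)

lemma IsCodingMap.eq_of_eq (hπF : IsCodingMap f K πF) (hπG : IsCodingMap g K' πG)
    (hK' : IsAttractor g K')
    (hg : ∀ i, IsSimilitude (g i) (r' i))
    (hauto : ∀ I J : List ι, I ≠ [] → I.length = J.length →
      (wordMap g I '' K') ∩ (wordMap g J '' K') = ∅ →
      (wordMap f I '' K) ∩ (wordMap f J '' K) = ∅)
    {x y : ℕ → ι} (h : πF x = πF y) : πG x = πG y := by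
  refine hπG.eq_of_forall_inter_nonempty hK' hg fun n => ?_
  rw [nonempty_iff_ne_empty]
  intro he
  have hne : pre x (n + 1) ≠ [] := by simp [pre_succ]
  have := hauto _ _ hne (by simp [pre_length]) he
  exact (this ▸ ⟨hπF.mem_image x n, h ▸ hπF.mem_image y n⟩ : πF x ∈ (∅ : Set X))

variable [MetricSpace X]

/-- `h` is a bijection from `K` to `K'` matching the two coding maps. -/
structure IsCodingConjugacy (K : Set X) (K' : Set Y) (πF : (ℕ → ι) → X) (πG : (ℕ → ι) → Y)
    (h : X → Y) : Prop where
  bijOn : BijOn h K K'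
  map_code : ∀ x, h (πF x) = πG x

lemma exists_codingConjugacy (hπF : IsCodingMap f K πF) (hπG : IsCodingMap g K' πG)
    (hK : IsAttractor f K) (hK' : IsAttractor g K')
    (hf : ∀ i, IsSimilitude (f i) (r i)) (hg : ∀ i, IsSimilitude (g i) (r' i))
    (hauto : ∀ I J : List ι, I ≠ [] → I.length = J.length →
      ((wordMap f I '' K) ∩ (wordMap f J '' K) = ∅ ↔
        (wordMap g I '' K') ∩ (wordMap g J '' K') = ∅)) :
    ∃ h : X → Y, IsCodingConjugacy K K' πF πG h := by
  have hFG : ∀ {x y}, πF x = πF y → πG x = πG y := fun {x y} =>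
    hπF.eq_of_eq hπG hK' hg fun I J h1 h2 => (hauto I J h1 h2).2
  have hGF : ∀ {x y}, πG x = πG y → πF x = πF y := fun {x y} =>
    hπG.eq_of_eq hπF hK hf fun I J h1 h2 => (hauto I J h1 h2).1
  obtain ⟨y₀, hy₀⟩ := hK'.1
  have hcode : ∀ a : X, ∃ b : Y, ∀ x, πF x = a → πG x = b := by
    intro a
    by_cases ha : ∃ x, πF x = a
    · obtain ⟨x, rfl⟩ := ha
      exact ⟨πG x, fun y hy => hFG hy⟩
    · exact ⟨y₀, fun x hx => absurd ⟨x, hx⟩ ha⟩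
  choose h hh using hcode
  have hmap : ∀ x, h (πF x) = πG x := fun x => (hh _ x rfl).symm
  refine ⟨h, ⟨?_, ?_, ?_⟩, hmap⟩
  · intro a ha
    obtain ⟨x, rfl⟩ := hπF.exists_code hK ha
    rw [hmap]
    exact hπG.mem hK' x
  · intro a ha b hb hab
    obtain ⟨x, rfl⟩ := hπF.exists_code hK ha
    obtain ⟨y, rfl⟩ := hπF.exists_code hK hb
    rw [hmap, hmap] at hab
    exact hGF hab
  · intro b hb
    obtain ⟨x, rfl⟩ := hπG.exists_code hK' hb
    exact ⟨πF x, hπF.mem hK x, hmap x⟩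

variable {h : X → Y}

lemma IsCodingConjugacy.map_apply (hc : IsCodingConjugacy K K' πF πG h)
    (hπF : IsCodingMap f K πF) (hπG : IsCodingMap g K' πG)
    (hK : IsAttractor f K) (hK' : IsAttractor g K') (i : ι) {a : X} (ha : a ∈ K) :
    h (f i a) = g i (h a) := by
  obtain ⟨x, rfl⟩ := hπF.exists_code hK ha
  rw [← hπF.map_cons hK, hc.map_code, hc.map_code, hπG.map_cons hK']

lemma IsCodingConjugacy.mem_image_iff (hc : IsCodingConjugacy K K' πF πG h)
    (hπF : IsCodingMap f K πF) (hπG : IsCodingMap g K' πG)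
    (hK : IsAttractor f K) (hK' : IsAttractor g K') (i : ι) {a : X} (ha : a ∈ K) :
    h a ∈ g i '' K' ↔ a ∈ f i '' K := by
  constructor
  · rintro ⟨b, hb, hab⟩
    obtain ⟨c, hcK, rfl⟩ := hc.bijOn.surjOn hb
    rw [← hc.map_apply hπF hπG hK hK' i hcK] at hab
    exact ⟨c, hcK, hc.bijOn.injOn (hK.map_mem hcK) ha hab⟩
  · rintro ⟨b, hb, rfl⟩
    exact ⟨h b, hc.bijOn.mapsTo hb, (hc.map_apply hπF hπG hK hK' i hb).symm⟩

/-- Two iterated function systems of contracting similitudes with their attractors and coding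
maps, conjugated by `h`. -/
structure IsSimilitudeConjugacy (f : ι → X → X) (g : ι → Y → Y) (K : Set X) (K' : Set Y)
    (πF : (ℕ → ι) → X) (πG : (ℕ → ι) → Y) (r r' : ι → ℝ) (h : X → Y) : Prop where
  attractor₁ : IsAttractor f K
  attractor₂ : IsAttractor g K'
  coding₁ : IsCodingMap f K πF
  coding₂ : IsCodingMap g K' πG
  ratio₁ : ∀ i, 0 < r i ∧ r i < 1
  ratio₂ : ∀ i, 0 < r' i ∧ r' i < 1
  similitude₁ : ∀ i, IsSimilitude (f i) (r i)
  similitude₂ : ∀ i, IsSimilitude (g i) (r' i)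
  conj : IsCodingConjugacy K K' πF πG h

namespace IsSimilitudeConjugacy

variable {s : ℝ}

lemma map_apply (H : IsSimilitudeConjugacy f g K K' πF πG r r' h) (i : ι) {a : X} (ha : a ∈ K) :
    h (f i a) = g i (h a) :=
  H.conj.map_apply H.coding₁ H.coding₂ H.attractor₁ H.attractor₂ i ha

lemma mem_image_iff (H : IsSimilitudeConjugacy f g K K' πF πG r r' h) (i : ι) {a : X}
    (ha : a ∈ K) : h a ∈ g i '' K' ↔ a ∈ f i '' K :=
  H.conj.mem_image_iff H.coding₁ H.coding₂ H.attractor₁ H.attractor₂ i ha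

/-- Distances to a post-critical point are transported by the power law `d ↦ d ^ s`, and their
scale is reached along boundary letters. -/
lemma exists_postCritical_comparison [Finite ι]
    (H : IsSimilitudeConjugacy f g K K' πF πG r r' h)
    (hP : (postCriticalSet f K).Finite) (hs : 0 < s)
    (hrs : ∀ i ∈ bdryLetters f K πF, r' i = r i ^ s) :
    ∃ C, 1 ≤ C ∧ ∀ p ∈ postCriticalSet f K, ∀ u : ℕ → ι,
      dist (πG u) (h p) ≤ C * dist (πF u) p ^ s ∧
      dist (πF u) p ^ s ≤ C * dist (πG u) (h p) ∧
      ∀ ε > 0, dist (πF u) p ≤ ε →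
        ∃ m, (∀ j < m, r' (u j) = r (u j) ^ s) ∧ prefixRatio r u m ≤ C * ε := by
  have : Finite (postCriticalSet f K) := hP
  obtain ⟨D, hD, hdD⟩ := H.attractor₁.exists_dist_le
  obtain ⟨D', hD', hdD'⟩ := H.attractor₂.exists_dist_le
  obtain ⟨δ, hδ, hsep⟩ := exists_uniform_separation
    (κ := postCriticalSet f K × ι) (A := fun q => f q.2 '' K) (B := fun q => {(q.1 : X)})
    (fun q => H.attractor₁.2.1.image (H.similitude₁ _).continuous) (fun q => isCompact_singleton)
  obtain ⟨δ', hδ', hsep'⟩ := exists_uniform_separation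
    (κ := postCriticalSet f K × ι) (A := fun q => g q.2 '' K') (B := fun q => {h (q.1 : X)})
    (fun q => H.attractor₂.2.1.image (H.similitude₂ _).continuous) (fun q => isCompact_singleton)
  have hr : ∀ i, 0 < r i := fun i => (H.ratio₁ i).1
  have hpos1 : 0 < D' / δ ^ s := by positivity
  have hpos2 : 0 < D ^ s / δ' := by positivity
  have hpos3 : 0 < 1 / δ := by positivity
  set C := 1 + D' / δ ^ s + D ^ s / δ' + 1 / δ
  refine ⟨C, by linarith, fun p hp u => ?_⟩
  have hC0 : 0 < C := by linarith
  by_cases hne : πF u = p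
  · subst hne
    rw [H.conj.map_code, dist_self, dist_self, Real.zero_rpow hs.ne']
    refine ⟨by simp, by simp, fun ε hε _ => ?_⟩
    obtain ⟨m, hm⟩ := ((prefixRatio_tendsto H.ratio₁ u).eventually
      (gt_mem_nhds (mul_pos hC0 hε))).exists
    exact ⟨m, fun j _ => hrs _ (H.coding₁.mem_bdryLetters H.attractor₁ hp j), hm.le⟩
  · obtain ⟨m, w, rfl, huw, hnot⟩ := H.coding₁.exists_maximal_code H.attractor₁ hp.1 hne
    have hw := H.coding₁.map_shift_mem_postCriticalSet H.attractor₁ hp m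
    have hm : ∀ j < m, r' (u j) = r (u j) ^ s := fun j hj => by
      rw [huw j hj]
      exact hrs _ (H.coding₁.mem_bdryLetters H.attractor₁ hp j)
    have hmem : πF (seqShift m u) ∈ f (u m) '' K := by
      simpa [seqShift] using H.coding₁.mem_image_head H.attractor₁ (seqShift m u)
    have hmem' : πG (seqShift m u) ∈ g (u m) '' K' := by
      simpa [seqShift] using H.coding₂.mem_image_head H.attractor₂ (seqShift m u)
    have he : δ ≤ dist (πF (seqShift m u)) (πF (seqShift m w)) :=
      hsep (⟨_, hw⟩, u m) (disjoint_singleton_right.2 hnot) _ hmem _ rfl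
    have he' : δ' ≤ dist (πG (seqShift m u)) (πG (seqShift m w)) := by
      rw [← H.conj.map_code (seqShift m w)]
      exact hsep' (⟨_, hw⟩, u m)
        (disjoint_singleton_right.2 fun h => hnot ((H.mem_image_iff _ hw.1).1 h)) _ hmem' _ rfl
    have hle := hdD _ (H.coding₁.mem H.attractor₁ (seqShift m u)) _
      (H.coding₁.mem H.attractor₁ (seqShift m w))
    have hle' := hdD' _ (H.coding₂.mem H.attractor₂ (seqShift m u)) _
      (H.coding₂.mem H.attractor₂ (seqShift m w))
    rw [H.conj.map_code, H.coding₁.dist_eq H.attractor₁ H.similitude₁ huw,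
      H.coding₂.dist_eq H.attractor₂ H.similitude₂ huw, prefixRatio_eq_rpow hr hm]
    have hρ := prefixRatio_pos hr u m
    set ρ := prefixRatio r u m
    set e := dist (πF (seqShift m u)) (πF (seqShift m w))
    set e' := dist (πG (seqShift m u)) (πG (seqShift m w))
    have he0 : 0 < e := hδ.trans_le he
    have hes : δ ^ s ≤ e ^ s := Real.rpow_le_rpow hδ.le he hs.le
    have hesD : e ^ s ≤ D ^ s := Real.rpow_le_rpow he0.le hle hs.le
    rw [Real.mul_rpow hρ.le he0.le]
    have h1 : e' ≤ C * e ^ s := by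
      calc e' ≤ D' / δ ^ s * δ ^ s := by rw [div_mul_cancel₀ _ (by positivity)]; exact hle'
        _ ≤ C * e ^ s := by gcongr; linarith
    have h2 : e ^ s ≤ C * e' := by
      calc e ^ s ≤ D ^ s / δ' * δ' := by rw [div_mul_cancel₀ _ (by positivity)]; exact hesD
        _ ≤ C * e' := by gcongr; linarith
    have hρs : 0 < ρ ^ s := by positivity
    refine ⟨by nlinarith, by nlinarith, fun ε hε hdε => ⟨m, hm, ?_⟩⟩
    calc ρ = 1 / δ * (ρ * δ) := by field_simp
      _ ≤ C * (ρ * e) := by gcongr; linarith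
      _ ≤ C * ε := by gcongr

lemma exists_firstLevel_disjoint_comparison [Finite ι]
    (H : IsSimilitudeConjugacy f g K K' πF πG r r' h) (hs : 0 < s) :
    ∃ C, 1 ≤ C ∧ ∀ x y : ℕ → ι, f (x 0) '' K ∩ f (y 0) '' K = ∅ →
      dist (πG x) (πG y) ≤ C * dist (πF x) (πF y) ^ s ∧
      dist (πF x) (πF y) ^ s ≤ C * dist (πG x) (πG y) ∧ 1 ≤ C * dist (πF x) (πF y) := by
  obtain ⟨D, hD, hdD⟩ := H.attractor₁.exists_dist_le
  obtain ⟨D', hD', hdD'⟩ := H.attractor₂.exists_dist_le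
  obtain ⟨δ, hδ, hsep⟩ := exists_uniform_separation
    (κ := ι × ι) (A := fun q => f q.1 '' K) (B := fun q => f q.2 '' K)
    (fun q => H.attractor₁.2.1.image (H.similitude₁ _).continuous)
    (fun q => H.attractor₁.2.1.image (H.similitude₁ _).continuous)
  obtain ⟨δ', hδ', hsep'⟩ := exists_uniform_separation
    (κ := ι × ι) (A := fun q => g q.1 '' K') (B := fun q => g q.2 '' K')
    (fun q => H.attractor₂.2.1.image (H.similitude₂ _).continuous)
    (fun q => H.attractor₂.2.1.image (H.similitude₂ _).continuous)
  have hpos1 : 0 < D' / δ ^ s := by positivity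
  have hpos2 : 0 < D ^ s / δ' := by positivity
  have hpos3 : 0 < 1 / δ := by positivity
  set C := 1 + D' / δ ^ s + D ^ s / δ' + 1 / δ
  refine ⟨C, by linarith, fun x y hxy => ?_⟩
  have hC0 : 0 < C := by linarith
  have hxy' : Disjoint (g (x 0) '' K') (g (y 0) '' K') := by
    rw [Set.disjoint_left]
    rintro _ ⟨b, hb, rfl⟩ hy
    obtain ⟨a, ha, rfl⟩ := H.conj.bijOn.surjOn hb
    rw [← H.map_apply _ ha, H.mem_image_iff _ (H.attractor₁.map_mem ha)] at hy
    exact (hxy ▸ ⟨⟨a, ha, rfl⟩, hy⟩ : f (x 0) a ∈ (∅ : Set X))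
  have he := hsep (x 0, y 0) (disjoint_iff_inter_eq_empty.2 hxy) _
    (H.coding₁.mem_image_head H.attractor₁ x) _ (H.coding₁.mem_image_head H.attractor₁ y)
  have he' := hsep' (x 0, y 0) hxy' _
    (H.coding₂.mem_image_head H.attractor₂ x) _ (H.coding₂.mem_image_head H.attractor₂ y)
  have hle := hdD _ (H.coding₁.mem H.attractor₁ x) _ (H.coding₁.mem H.attractor₁ y)
  have hle' := hdD' _ (H.coding₂.mem H.attractor₂ x) _ (H.coding₂.mem H.attractor₂ y)
  set e := dist (πF x) (πF y)
  set e' := dist (πG x) (πG y)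
  have he0 : 0 < e := hδ.trans_le he
  have hes : δ ^ s ≤ e ^ s := Real.rpow_le_rpow hδ.le he hs.le
  have hesD : e ^ s ≤ D ^ s := Real.rpow_le_rpow he0.le hle hs.le
  refine ⟨?_, ?_, ?_⟩
  · calc e' ≤ D' / δ ^ s * δ ^ s := by rw [div_mul_cancel₀ _ (by positivity)]; exact hle'
      _ ≤ C * e ^ s := by gcongr; linarith
  · calc e ^ s ≤ D ^ s / δ' * δ' := by rw [div_mul_cancel₀ _ (by positivity)]; exact hesD
      _ ≤ C * e' := by gcongr; linarith
  · calc 1 = 1 / δ * δ := by field_simp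
      _ ≤ C * e := by gcongr; linarith

/-- Distances from a point `z` where two first-level cells meet, measured inside one of them. -/
lemma exists_contact_comparison [Finite ι]
    (H : IsSimilitudeConjugacy f g K K' πF πG r r' h)
    (hP : (postCriticalSet f K).Finite) (hs : 0 < s)
    (hrs : ∀ i ∈ bdryLetters f K πF, r' i = r i ^ s) :
    ∃ C, 1 ≤ C ∧ ∀ (x : ℕ → ι) (j : ι), x 0 ≠ j → ∀ z ∈ f (x 0) '' K ∩ f j '' K,
      dist (πG x) (h z) ≤ C * dist (πF x) z ^ s ∧
      dist (πF x) z ^ s ≤ C * dist (πG x) (h z) ∧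
      ∀ ε > 0, dist (πF x) z ≤ ε →
        ∃ m, (∀ j < m, r' (seqShift 1 x j) = r (seqShift 1 x j) ^ s) ∧
          prefixRatio r (seqShift 1 x) m ≤ C * ε := by
  obtain ⟨C, hC, hcomp⟩ := H.exists_postCritical_comparison hP hs hrs
  obtain ⟨ρ, hρ, hle⟩ := exists_pos_le_of_finite fun i => (H.ratio₁ i).1
  obtain ⟨ρ', hρ', hle'⟩ := exists_pos_le_of_finite fun i => (H.ratio₂ i).1
  have hC0 : 0 < C := by linarith
  have hpos1 : 0 < C / ρ ^ s := by positivity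
  have hpos2 : 0 < C / ρ' := by positivity
  have hpos3 : 0 < C / ρ := by positivity
  set E := 1 + C / ρ ^ s + C / ρ' + C / ρ
  refine ⟨E, by linarith, ?_⟩
  rintro x j hxj _ ⟨⟨p, hp, rfl⟩, q, hq, hpq⟩
  obtain ⟨h1, h2, h3⟩ :=
    hcomp p (mem_postCriticalSet_of_eq hxj hp hq hpq.symm) (seqShift 1 x)
  rw [H.map_apply _ hp, ← H.coding₁.map_shift H.attractor₁ x,
    ← H.coding₂.map_shift H.attractor₂ x, H.similitude₁, H.similitude₂]
  set e := dist (πF (seqShift 1 x)) p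
  set e' := dist (πG (seqShift 1 x)) (h p)
  have he : 0 ≤ e := dist_nonneg
  have he' : 0 ≤ e' := dist_nonneg
  have hi := H.ratio₁ (x 0)
  have hi' := H.ratio₂ (x 0)
  have hes : 0 ≤ e ^ s := by positivity
  refine ⟨?_, ?_, fun ε hε hdε => ?_⟩
  · calc r' (x 0) * e' ≤ 1 * (C * e ^ s) := by
          gcongr
          exact hi'.2.le
      _ = C / ρ ^ s * (ρ ^ s * e ^ s) := by field_simp
      _ ≤ E * (r (x 0) ^ s * e ^ s) := by
          gcongr
          · linarith
          · exact hle _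
      _ = _ := by rw [Real.mul_rpow hi.1.le he]
  · calc (r (x 0) * e) ^ s ≤ e ^ s :=
          Real.rpow_le_rpow (mul_nonneg hi.1.le he) (mul_le_of_le_one_left he hi.2.le) hs.le
      _ ≤ C / ρ' * (ρ' * e') := by
          have : C / ρ' * (ρ' * e') = C * e' := by field_simp
          rwa [this]
      _ ≤ E * (r' (x 0) * e') := by
          gcongr
          · linarith
          · exact hle' _
  · obtain ⟨m, hm, hmε⟩ := h3 (ε / ρ) (by positivity) (by
      rw [le_div_iff₀ hρ]
      calc e * ρ ≤ e * r (x 0) := by gcongr; exact hle _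
        _ ≤ ε := by linarith)
    refine ⟨m, hm, hmε.trans ?_⟩
    calc C * (ε / ρ) = C / ρ * ε := by ring
      _ ≤ E * ε := by gcongr; linarith

/-- Distances between points of distinct first-level cells. -/
lemma exists_firstLevel_comparison [Finite ι]
    (H : IsSimilitudeConjugacy f g K K' πF πG r r' h)
    (hP : (postCriticalSet f K).Finite) (hs : 0 < s)
    (hrs : ∀ i ∈ bdryLetters f K πF, r' i = r i ^ s)
    (hSICf : SIC f K) (hASCf : ASC f K) (hASCg : ASC g K') :
    ∃ C, 1 ≤ C ∧ ∀ x y : ℕ → ι, x 0 ≠ y 0 → πF x ≠ πF y →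
      dist (πG x) (πG y) ≤ C * dist (πF x) (πF y) ^ s ∧
      dist (πF x) (πF y) ^ s ≤ C * dist (πG x) (πG y) ∧
      ∃ m, (∀ j < m, r' (seqShift 1 x j) = r (seqShift 1 x j) ^ s) ∧
        prefixRatio r (seqShift 1 x) m ≤ C * dist (πF x) (πF y) := by
  obtain ⟨C, hC, hcomp⟩ := H.exists_contact_comparison hP hs hrs
  obtain ⟨C₁, hC₁, hdisj⟩ := H.exists_firstLevel_disjoint_comparison hs
  obtain ⟨c, hc, hasc⟩ := hASCf
  obtain ⟨c', hc', hasc'⟩ := hASCg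
  have hC0 : 0 < C := by linarith
  have hpos1 : 0 < 2 * C / c ^ s := by positivity
  have hpos2 : 0 < 2 ^ s * C / c' := by positivity
  have hpos3 : 0 < C / c := by positivity
  set E := C₁ + 2 * C / c ^ s + 2 ^ s * C / c' + C / c
  refine ⟨E, by linarith, fun x y hxy hne => ?_⟩
  have hd : 0 < dist (πF x) (πF y) := dist_pos.2 hne
  have hx := H.coding₁.mem_image_head H.attractor₁ x
  have hy := H.coding₁.mem_image_head H.attractor₁ y
  have hx' := H.coding₂.mem_image_head H.attractor₂ x
  have hy' := H.coding₂.mem_image_head H.attractor₂ y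
  have hEpos : 0 < E := by linarith
  rcases (f (x 0) '' K ∩ f (y 0) '' K).eq_empty_or_nonempty with hemp | ⟨z, hz⟩
  · obtain ⟨h1, h2, h3⟩ := hdisj x y hemp
    have hCE : C₁ ≤ E := by linarith
    refine ⟨h1.trans (by gcongr), h2.trans (by gcongr), 0, by simp, ?_⟩
    simp only [prefixRatio, Finset.range_zero, Finset.prod_empty]
    exact h3.trans (by gcongr)
  · have hzK : z ∈ K := H.attractor₁.image_subset _ hz.1
    have hz1 : f (x 0) '' K ∩ f (y 0) '' K = {z} := (hSICf _ _ hxy).eq_singleton_of_mem hz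
    have hz2 : g (x 0) '' K' ∩ g (y 0) '' K' = {h z} := by
      refine Subset.antisymm ?_ (singleton_subset_iff.2
        ⟨(H.mem_image_iff _ hzK).2 hz.1, (H.mem_image_iff _ hzK).2 hz.2⟩)
      rintro b ⟨hb1, hb2⟩
      obtain ⟨a, ha, rfl⟩ := H.conj.bijOn.surjOn (H.attractor₂.image_subset _ hb1)
      have : a ∈ f (x 0) '' K ∩ f (y 0) '' K :=
        ⟨(H.mem_image_iff _ ha).1 hb1, (H.mem_image_iff _ ha).1 hb2⟩
      rw [hz1] at this
      rw [mem_singleton_iff.1 this]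
      rfl
    have ha := hasc _ _ hxy z hz1 _ hx _ hy
    have ha' := hasc' _ _ hxy (h z) hz2 _ hx' _ hy'
    obtain ⟨h1, h2, h3⟩ := hcomp x (y 0) hxy z hz
    obtain ⟨h4, h5, -⟩ := hcomp y (x 0) hxy.symm z hz.symm
    have htri := dist_triangle_right (πF x) (πF y) z
    have htri' := dist_triangle_right (πG x) (πG y) (h z)
    set d := dist (πF x) (πF y)
    set d' := dist (πG x) (πG y)
    set u := dist (πF x) z
    set v := dist (πF y) z
    set u' := dist (πG x) (h z)
    set v' := dist (πG y) (h z)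
    have hu : 0 ≤ u := dist_nonneg
    have hv : 0 ≤ v := dist_nonneg
    set M := max u v
    set M' := max u' v'
    have hM : 0 ≤ M := hu.trans (le_max_left _ _)
    have huM : u ^ s ≤ M ^ s := Real.rpow_le_rpow hu (le_max_left _ _) hs.le
    have hvM : v ^ s ≤ M ^ s := Real.rpow_le_rpow hv (le_max_right _ _) hs.le
    have hMM : M ^ s ≤ C * M' := by
      rcases max_choice u v with h | h
      · calc M ^ s = u ^ s := congrArg (· ^ s) h
          _ ≤ C * u' := h2
          _ ≤ C * M' := by gcongr; exact le_max_left _ _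
      · calc M ^ s = v ^ s := congrArg (· ^ s) h
          _ ≤ C * v' := h5
          _ ≤ C * M' := by gcongr; exact le_max_right _ _
    refine ⟨?_, ?_, ?_⟩
    · calc d' ≤ u' + v' := htri'
        _ ≤ C * M ^ s + C * M ^ s :=
          add_le_add (h1.trans (by gcongr)) (h4.trans (by gcongr))
        _ = 2 * C / c ^ s * (c * M) ^ s := by
          rw [Real.mul_rpow hc.le hM]
          field_simp
          ring
        _ ≤ E * d ^ s := by
          gcongr
          linarith
    · calc d ^ s ≤ (2 * M) ^ s := by
            refine Real.rpow_le_rpow hd.le ?_ hs.le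
            linarith [le_max_left u v, le_max_right u v]
        _ = 2 ^ s * M ^ s := Real.mul_rpow (by norm_num) hM
        _ ≤ 2 ^ s * (C * M') := by gcongr
        _ = 2 ^ s * C / c' * (c' * M') := by field_simp
        _ ≤ E * d' := by
          gcongr
          linarith
    · obtain ⟨m, hm, hle⟩ := h3 (d / c) (by positivity) (by
        rw [le_div_iff₀ hc]
        calc u * c ≤ M * c := by gcongr; exact le_max_left _ _
          _ ≤ d := by linarith)
      refine ⟨m, hm, hle.trans ?_⟩
      calc C * (d / c) = C / c * d := by ring
        _ ≤ E * d := by gcongr; linarith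

lemma exists_hasScale [Finite ι]
    (H : IsSimilitudeConjugacy f g K K' πF πG r r' h)
    (hP : (postCriticalSet f K).Finite) (hs : 0 < s)
    (hrs : ∀ i ∈ bdryLetters f K πF, r' i = r i ^ s)
    (hSICf : SIC f K) (hASCf : ASC f K) (hASCg : ASC g K') :
    ∃ C, 1 ≤ C ∧ ∀ x y : ℕ → ι, πF x ≠ πF y →
      HasScale r r' s C x (dist (πF x) (πF y)) (dist (πG x) (πG y)) := by
  classical
  obtain ⟨C, hC, hcomp⟩ := H.exists_firstLevel_comparison hP hs hrs hSICf hASCf hASCg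
  obtain ⟨D, hD, hdD⟩ := H.attractor₁.exists_dist_le
  obtain ⟨ρ, hρ, hle⟩ := exists_pos_le_of_finite fun i => (H.ratio₁ i).1
  obtain ⟨ρ', hρ', hle'⟩ := exists_pos_le_of_finite fun i => (H.ratio₂ i).1
  have hr : ∀ i, 0 < r i := fun i => (H.ratio₁ i).1
  have hr' : ∀ i, 0 < r' i := fun i => (H.ratio₂ i).1
  have hC0 : 0 < C := by linarith
  have hpos1 : 0 < C / ρ ^ s := by positivity
  have hpos2 : 0 < C / ρ' := by positivity
  have hpos3 : 0 < D / ρ := by positivity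
  set E := C + C / ρ ^ s + C / ρ' + D / ρ
  have hEpos : 0 < E := by linarith
  refine ⟨E, by linarith, fun x y hne => ?_⟩
  have hex : ∃ k, x k ≠ y k := by
    by_contra! hcon
    exact hne (congrArg πF (funext hcon))
  obtain ⟨k, hk, hmin⟩ : ∃ k, x k ≠ y k ∧ ∀ j < k, x j = y j :=
    ⟨Nat.find hex, Nat.find_spec hex, fun j hj => not_not.1 (Nat.find_min hex hj)⟩
  have hd := H.coding₁.dist_eq H.attractor₁ H.similitude₁ hmin
  have hd' := H.coding₂.dist_eq H.attractor₂ H.similitude₂ hmin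
  have hne' : πF (seqShift k x) ≠ πF (seqShift k y) := by
    intro heq
    rw [heq, dist_self, mul_zero] at hd
    exact hne (dist_eq_zero.1 hd)
  obtain ⟨h1, h2, m, hm, hmle⟩ :=
    hcomp (seqShift k x) (seqShift k y) (by simpa [seqShift] using hk) hne'
  have heD := hdD _ (H.coding₁.mem H.attractor₁ (seqShift k x)) _
    (H.coding₁.mem H.attractor₁ (seqShift k y))
  have he : 0 < dist (πF (seqShift k x)) (πF (seqShift k y)) := dist_pos.2 hne'
  have he' : 0 ≤ dist (πG (seqShift k x)) (πG (seqShift k y)) := dist_nonneg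
  rw [seqShift_seqShift] at hm hmle
  rw [hd, hd']
  set e := dist (πF (seqShift k x)) (πF (seqShift k y))
  set e' := dist (πG (seqShift k x)) (πG (seqShift k y))
  have hP0 := prefixRatio_pos hr x k
  have hP0' := prefixRatio_pos hr' x k
  have hi := H.ratio₁ (x k)
  have hi' := H.ratio₂ (x k)
  have hQ := (prefixRatio_pos hr (seqShift (k + 1) x) m).le
  have hT : transferredDist r r' s x (k + 1) (prefixRatio r x k * e) =
      prefixRatio r' x k * r' (x k) * (e / r (x k)) ^ s := by
    rw [transferredDist, prefixRatio_succ, prefixRatio_succ, mul_div_mul_left _ _ hP0.ne']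
  have hes : 0 < e ^ s := by positivity
  have hxr : 0 < r (x k) := hi.1
  have hxr' : 0 < r' (x k) := hi'.1
  have hediv : 0 ≤ e / r (x k) := by positivity
  refine ⟨k + 1, k + 1 + m, by omega, fun l hl1 hl2 => ?_, ?_, ?_, ?_, ?_⟩
  · obtain ⟨j, rfl⟩ := Nat.exists_eq_add_of_le hl1
    have := hm j (by omega)
    rwa [seqShift, add_comm j (k + 1)] at this
  · rw [prefixRatio_add, prefixRatio_succ]
    calc prefixRatio r x k * r (x k) * prefixRatio r (seqShift (k + 1) x) m
        ≤ prefixRatio r x k * 1 * (C * e) := by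
          gcongr
          exact hi.2.le
      _ = C * (prefixRatio r x k * e) := by ring
      _ ≤ E * (prefixRatio r x k * e) := by gcongr; linarith
  · rw [prefixRatio_succ]
    calc prefixRatio r x k * e ≤ prefixRatio r x k * D := by gcongr
      _ = D / ρ * (prefixRatio r x k * ρ) := by field_simp
      _ ≤ E * (prefixRatio r x k * r (x k)) := by
          gcongr
          · linarith
          · exact hle _
  · rw [hT]
    calc prefixRatio r' x k * e' ≤ prefixRatio r' x k * (C * e ^ s) := by gcongr
      _ = C / ρ' * (prefixRatio r' x k * ρ' * e ^ s) := by field_simp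
      _ ≤ E * (prefixRatio r' x k * r' (x k) * (e / r (x k)) ^ s) := by
          gcongr
          · linarith
          · exact hle' _
          · exact le_div_self he.le hi.1 hi.2.le
  · rw [hT]
    calc prefixRatio r' x k * r' (x k) * (e / r (x k)) ^ s
        ≤ prefixRatio r' x k * 1 * (e / ρ) ^ s := by
          gcongr
          · exact hi'.2.le
          · exact hle _
      _ = prefixRatio r' x k / ρ ^ s * e ^ s := by
          rw [Real.div_rpow he.le hρ.le]
          ring
      _ ≤ prefixRatio r' x k / ρ ^ s * (C * e') := by gcongr
      _ = C / ρ ^ s * (prefixRatio r' x k * e') := by ring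
      _ ≤ E * (prefixRatio r' x k * e') := by gcongr; linarith

/-- The conjugacy distorts ratios of distances by at most a power-type function. -/
lemma exists_power_distortion [Finite ι]
    (H : IsSimilitudeConjugacy f g K K' πF πG r r' h)
    (hP : (postCriticalSet f K).Finite) (hs : 0 < s)
    (hrs : ∀ i ∈ bdryLetters f K πF, r' i = r i ^ s)
    (hSICf : SIC f K) (hASCf : ASC f K) (hASCg : ASC g K') :
    ∃ C α β : ℝ, 0 < C ∧ 0 < α ∧ 0 < β ∧ ∀ a ∈ K, ∀ b ∈ K, ∀ c ∈ K, ∀ t, 0 ≤ t →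
      dist a b ≤ t * dist a c →
        dist (h a) (h b) ≤ C * (t ^ α + t ^ β) * dist (h a) (h c) := by
  obtain ⟨C, hC, hscale⟩ := H.exists_hasScale hP hs hrs hSICf hASCf hASCg
  obtain ⟨α, β, hα, hαs, hsβ, hrα, hrβ⟩ := exists_rpow_bounds H.ratio₁ H.ratio₂ hs
  have hC0 : 0 < C := by linarith
  refine ⟨C ^ 2 * (C ^ β) ^ 2, α, β, by positivity, hα, by linarith, ?_⟩
  intro a ha b hb c hc t ht hle
  obtain ⟨x, rfl⟩ := H.coding₁.exists_code H.attractor₁ ha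
  obtain ⟨y, rfl⟩ := H.coding₁.exists_code H.attractor₁ hb
  obtain ⟨z, rfl⟩ := H.coding₁.exists_code H.attractor₁ hc
  by_cases hxy : πF x = πF y
  · rw [hxy, dist_self]
    positivity
  have hd₁ : 0 < dist (πF x) (πF y) := dist_pos.2 hxy
  have hd₂ : 0 < dist (πF x) (πF z) := pos_of_mul_pos_right (hd₁.trans_le hle) ht
  rw [H.conj.map_code, H.conj.map_code, H.conj.map_code]
  refine (HasScale.le (fun i => (H.ratio₁ i).1) (fun i => (H.ratio₂ i).1) hα hαs hsβ hrα hrβ hC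
    hd₁ hd₂ (hscale x y hxy) (hscale x z (dist_pos.1 hd₂))).trans ?_
  have hdt : dist (πF x) (πF y) / dist (πF x) (πF z) ≤ t := (div_le_iff₀ hd₂).2 hle
  have hβ : 0 ≤ β := by linarith
  gcongr

end IsSimilitudeConjugacy

end Conjugacy

lemma powerDistortion_homeomorphism {C α β : ℝ} (hC : 0 < C) (hα : 0 < α) (hβ : 0 < β) :
    StrictMonoOn (fun t : ℝ => C * (t ^ α + t ^ β)) (Ici 0) ∧
      MapsTo (fun t : ℝ => C * (t ^ α + t ^ β)) (Ici 0) (Ici 0) ∧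
      SurjOn (fun t : ℝ => C * (t ^ α + t ^ β)) (Ici 0) (Ici 0) ∧
      ContinuousOn (fun t : ℝ => C * (t ^ α + t ^ β)) (Ici 0) := by
  have hcont : Continuous (fun t : ℝ => C * (t ^ α + t ^ β)) :=
    continuous_const.mul
      ((Real.continuous_rpow_const hα.le).add (Real.continuous_rpow_const hβ.le))
  refine ⟨fun a ha b _ hab => ?_, fun t ht => ?_, ?_, hcont.continuousOn⟩
  · have h1 := Real.rpow_lt_rpow ha hab hα
    have h2 := Real.rpow_lt_rpow ha hab hβ
    exact mul_lt_mul_of_pos_left (add_lt_add h1 h2) hC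
  · have ht' : (0 : ℝ) ≤ t := ht
    exact mem_Ici.2 (by positivity)
  · intro v hv
    have hlim : Filter.Tendsto (fun t : ℝ => C * (t ^ α + t ^ β)) Filter.atTop Filter.atTop :=
      ((tendsto_rpow_atTop hα).atTop_add_atTop (tendsto_rpow_atTop hβ)).const_mul_atTop hC
    obtain ⟨b, hvb, hb⟩ :=
      ((hlim.eventually_ge_atTop v).and (Filter.eventually_ge_atTop 0)).exists
    obtain ⟨t, ht, rfl⟩ := intermediate_value_Icc hb hcont.continuousOn
      (show v ∈ Icc _ _ from ⟨by simpa [Real.zero_rpow hα.ne', Real.zero_rpow hβ.ne'] using hv, hvb⟩)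
    exact ⟨t, ht.1, rfl⟩

/-- A map that distorts ratios of distances by a function `η` vanishing continuously at `0` is
continuous. -/
lemma continuous_of_ratio_distortion {X Y : Type*} [MetricSpace X] [MetricSpace Y] {h : X → Y}
    {η : ℝ → ℝ} (hη : ContinuousOn η (Ici 0)) (hη0 : η 0 = 0)
    (hh : ∀ x y z : X, ∀ t : ℝ, 0 ≤ t → dist x y ≤ t * dist x z →
      dist (h x) (h y) ≤ η t * dist (h x) (h z)) : Continuous h := by
  rw [continuous_iff_continuousAt]
  intro a
  by_cases hz : ∃ z, z ≠ a
  · obtain ⟨z, hz⟩ := hz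
    have hd : 0 < dist a z := dist_pos.2 hz.symm
    have h1 : Filter.Tendsto (fun b => dist a b / dist a z) (nhds a) (nhdsWithin 0 (Ici 0)) := by
      refine tendsto_nhdsWithin_iff.2 ⟨?_, Filter.Eventually.of_forall fun b => ?_⟩
      · have : Continuous fun b => dist a b / dist a z := by fun_prop
        simpa using this.tendsto a
      · exact mem_Ici.2 (by positivity)
    have h2 := ((hη 0 self_mem_Ici).tendsto.comp h1).mul_const (dist (h a) (h z))
    rw [hη0, zero_mul] at h2
    refine tendsto_iff_dist_tendsto_zero.2 (squeeze_zero (fun _ => dist_nonneg) (fun b => ?_) h2)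
    rw [dist_comm]
    exact hh a b z _ (by positivity) (by rw [div_mul_cancel₀ _ hd.ne'])
  · push Not at hz
    have : Subsingleton X := ⟨fun x y => (hz x).trans (hz y).symm⟩
    exact continuous_of_discreteTopology.continuousAt

/-- **Theorem (quasisymmetric equivalence).**
If `F` and `G` are p.c.f. IFSs of contracting similitudes on complete metric spaces,
both satisfying the SIC and the ASC, with the same topology automaton, and if there is
`s > 0` with `r'_i = (r_i)^s` for every `i ∈ ∂Σ_K`, then the attractors are
quasisymmetrically equivalent. -/
theorem quasisymmetric_equivalence_of_same_automaton
    {X Y : Type*} [MetricSpace X] [MetricSpace Y] [CompleteSpace X] [CompleteSpace Y]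
    {N : ℕ} (f : Fin N → X → X) (g : Fin N → Y → Y) (K : Set X) (K' : Set Y)
    (r r' : Fin N → ℝ)
    (hr : ∀ i, 0 < r i ∧ r i < 1) (hr' : ∀ i, 0 < r' i ∧ r' i < 1)
    (hf : ∀ i, IsSimilitude (f i) (r i)) (hg : ∀ i, IsSimilitude (g i) (r' i))
    (πF : (ℕ → Fin N) → X) (πG : (ℕ → Fin N) → Y)
    (hK : IsAttractor f K) (hK' : IsAttractor g K')
    (hπF : IsCodingMap f K πF) (hπG : IsCodingMap g K' πG)
    (hpcfF : (πF ⁻¹' postCriticalSet f K).Finite)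
    (hpcfG : (πG ⁻¹' postCriticalSet g K').Finite)
    (hSICf : SIC f K) (hSICg : SIC g K')
    (hASCf : ASC f K) (hASCg : ASC g K')
    (hauto : ∀ I J : List (Fin N), I ≠ [] → I.length = J.length →
      ((wordMap f I '' K) ∩ (wordMap f J '' K) = ∅ ↔
        (wordMap g I '' K') ∩ (wordMap g J '' K') = ∅))
    (hratios : ∃ s : ℝ, 0 < s ∧ ∀ i ∈ bdryLetters f K πF, r' i = r i ^ s) :
    ∃ (h : K ≃ₜ K') (η : ℝ → ℝ),
      StrictMonoOn η (Set.Ici 0) ∧ Set.MapsTo η (Set.Ici 0) (Set.Ici 0) ∧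
      Set.SurjOn η (Set.Ici 0) (Set.Ici 0) ∧ ContinuousOn η (Set.Ici 0) ∧
      ∀ x y z : K, ∀ t : ℝ, 0 ≤ t → dist x y ≤ t * dist x z →
        dist (h x) (h y) ≤ η t * dist (h x) (h z) := by
  obtain ⟨s, hs, hrs⟩ := hratios
  obtain ⟨h, hh⟩ := exists_codingConjugacy hπF hπG hK hK' hf hg hauto
  have H : IsSimilitudeConjugacy f g K K' πF πG r r' h :=
    ⟨hK, hK', hπF, hπG, hr, hr', hf, hg, hh⟩
  obtain ⟨C, α, β, hC, hα, hβ, hdist⟩ := H.exists_power_distortion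
    (hπF.finite_postCriticalSet hK hpcfF) hs hrs hSICf hASCf hASCg
  obtain ⟨hmono, hmaps, hsurj, hcont⟩ := powerDistortion_homeomorphism hC hα hβ
  have hqs : ∀ x y z : K, ∀ t : ℝ, 0 ≤ t → dist x y ≤ t * dist x z →
      dist (hh.bijOn.equiv h x) (hh.bijOn.equiv h y) ≤
        C * (t ^ α + t ^ β) * dist (hh.bijOn.equiv h x) (hh.bijOn.equiv h z) :=
    fun x y z => hdist x x.2 y y.2 z z.2
  have hc : Continuous (hh.bijOn.equiv h) := continuous_of_ratio_distortion hcont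
    (by simp [Real.zero_rpow hα.ne', Real.zero_rpow hβ.ne']) hqs
  have : CompactSpace K := isCompact_iff_compactSpace.1 hK.2.1
  exact ⟨hc.homeoOfEquivCompactToT2, _, hmono, hmaps, hsurj, hcont, hqs⟩
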